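/- Let p ≥ 1, let μ, β be vectors in ℝ^p, let A be an invertible p×p real matrix, and let λ, χ, ψ ∈ ℝ satisfy: (χ ≥ 0 and ψ > 0) if λ > 0; (χ > 0 and ψ > 0) if λ = 0; (χ > 0 and ψ ≥ 0) if λ < 0. Define f : ℝ^p → [0,∞] by f(y) = |det A|^{-1} ∫₀^∞ (2πx)^{-p/2} · exp(−‖A⁻¹(y − μ − xβ)‖²/(2x)) · x^{λ−1} exp(−(χ/x + ψx)/2) dx. Then f(y) ≤ f(μ) for all y ∈ ℝ^p if and only if β = 0, or (χ = 0 and 0 < λ ≤ (p+1)/2). -/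

import Mathlib

open MeasureTheory Set Real ENNReal

noncomputable def gigG (ν P q x : ℝ) : ℝ := x ^ (ν - 1) * Real.exp (-q / (2 * x) - P * x / 2)

noncomputable def gigH (ν P q : ℝ) : ℝ≥0∞ := ∫⁻ x in Ioi (0:ℝ), ENNReal.ofReal (gigG ν P q x)

lemma gigG_meas (ν P q : ℝ) : Measurable (gigG ν P q) := by
  unfold gigG; fun_prop

lemma gigG_nonneg (ν P q x : ℝ) (hx : 0 < x) : 0 ≤ gigG ν P q x := by
  unfold gigG; positivity

lemma gigG_pos (ν P q x : ℝ) (hx : 0 < x) : 0 < gigG ν P q x := by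
  unfold gigG; positivity

lemma gigH_anti (ν P q q' : ℝ) (h : q ≤ q') : gigH ν P q' ≤ gigH ν P q := by
  unfold gigH
  refine setLIntegral_mono' measurableSet_Ioi ?_
  intro x hx
  have hx : 0 < x := hx
  apply ENNReal.ofReal_le_ofReal
  unfold gigG
  gcongr

lemma gigG_int0 (ν P q : ℝ) (hP : 0 < P) (hν : 0 < ν) (hq : 0 ≤ q) :
    IntegrableOn (gigG ν P q) (Ioi 0) := by
  have h1 := integrableOn_rpow_mul_exp_neg_mul_rpow (p := 1) (s := ν - 1) (b := P / 2)
    (by linarith) one_pos (by positivity)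
  refine Integrable.mono' h1 (gigG_meas _ _ _).aestronglyMeasurable ?_
  filter_upwards [ae_restrict_mem measurableSet_Ioi] with x hx
  have hx : 0 < x := hx
  rw [Real.norm_of_nonneg (gigG_nonneg _ _ _ _ hx)]
  unfold gigG
  rw [Real.rpow_one]
  gcongr
  have : 0 ≤ q / (2 * x) := by positivity
  rw [neg_div]
  linarith

lemma gigG_int1 (ν P q : ℝ) (hP : 0 < P) (hq : 0 < q) :
    IntegrableOn (gigG ν P q) (Ioi 0) := by
  obtain ⟨n, hn⟩ := exists_nat_gt (-ν)
  have h1 := integrableOn_rpow_mul_exp_neg_mul_rpow (p := 1) (s := ν - 1 + n) (b := P / 2)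
    (by linarith) one_pos (by positivity)
  refine Integrable.mono' (h1.const_mul (n.factorial * (2 / q) ^ n))
    (gigG_meas _ _ _).aestronglyMeasurable ?_
  filter_upwards [ae_restrict_mem measurableSet_Ioi] with x hx
  have hx : 0 < x := hx
  rw [Real.norm_of_nonneg (gigG_nonneg _ _ _ _ hx)]
  unfold gigG
  rw [Real.rpow_one, Real.rpow_add hx, Real.rpow_natCast, sub_eq_add_neg (-q / (2 * x)),
    Real.exp_add]
  have h2 := Real.pow_div_factorial_le_exp (q / (2 * x)) (by positivity) n
  have h3 : Real.exp (-q / (2 * x)) ≤ n.factorial * (2 / q) ^ n * x ^ n := by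
    rw [neg_div, Real.exp_neg]
    rw [inv_le_comm₀ (Real.exp_pos _) (by positivity)]
    refine le_trans (le_of_eq ?_) h2
    have : (2/q)^n * x^n * (q/(2*x))^n = 1 := by
      rw [← mul_pow, ← mul_pow]
      have : 2 / q * x * (q / (2 * x)) = 1 := by field_simp
      rw [this, one_pow]
    have hf : (n.factorial : ℝ) ≠ 0 := by positivity
    rw [inv_eq_iff_eq_inv, inv_div, _root_.eq_div_iff (by positivity)]
    linear_combination (n.factorial : ℝ) * this
  have h4 : -(P * x / 2) = -(P/2) * x := by ring
  rw [h4]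
  calc _ ≤ x ^ (ν - 1) * (n.factorial * (2 / q) ^ n * x ^ n * Real.exp (-(P/2) * x)) := by gcongr
    _ = _ := by ring

lemma gigG_int (ν P q : ℝ) (hP : 0 < P) (hq : 0 ≤ q) (h : 0 < q ∨ 0 < ν) :
    IntegrableOn (gigG ν P q) (Ioi 0) := by
  rcases h with h | h
  · exact gigG_int1 ν P q hP h
  · exact gigG_int0 ν P q hP h hq

lemma gigH_eq (ν P q : ℝ) (hP : 0 < P) (hq : 0 ≤ q) (h : 0 < q ∨ 0 < ν) :
    gigH ν P q = ENNReal.ofReal (∫ x in Ioi (0:ℝ), gigG ν P q x) := by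
  unfold gigH
  rw [ofReal_integral_eq_lintegral_ofReal (gigG_int ν P q hP hq h)]
  filter_upwards [ae_restrict_mem measurableSet_Ioi] with x hx
  exact gigG_nonneg _ _ _ _ hx

lemma one_sub_exp_le (a θ : ℝ) (ha : 0 < a) (h0 : 0 < θ) (h1 : θ ≤ 1) :
    1 - Real.exp (-a) ≤ a ^ θ := by
  rcases le_total a 1 with h | h
  · have := Real.rpow_le_rpow_of_exponent_ge ha h h1
    rw [Real.rpow_one] at this
    have := Real.add_one_le_exp (-a)
    linarith
  · have := Real.one_le_rpow h h0.le
    have := Real.exp_pos (-a)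
    linarith

lemma gig_fwd (ν P χ B : ℝ) (hP : 0 < P) (hχ : 0 ≤ χ) (hB : 0 < B) (h : 0 < χ ∨ 1/2 < ν)
    (H : ∀ ε : ℝ, 0 < ε → ENNReal.ofReal (Real.exp (ε * B)) * gigH ν P (χ + ε ^ 2 * B)
      ≤ gigH ν P χ) : False := by
  obtain ⟨θ, hθ0, hθ1, hθ⟩ : ∃ θ : ℝ, 1/2 < θ ∧ θ ≤ 1 ∧ (0 < χ ∨ 0 < ν - θ) := by
    rcases h with h | h
    · exact ⟨1, by norm_num, le_rfl, Or.inl h⟩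
    · obtain ⟨θ, h1, h2⟩ := exists_between (lt_min h (show (1/2:ℝ) < 1 by norm_num))
      exact ⟨θ, h1, (h2.trans_le (min_le_right _ _)).le,
        Or.inr (by linarith [h2.trans_le (min_le_left ν 1)])⟩
  have hν : 0 < χ ∨ 0 < ν := h.imp id (fun h => by linarith)
  set I0 := ∫ x in Ioi (0:ℝ), gigG ν P χ x with hI0
  set M := ∫ x in Ioi (0:ℝ), gigG (ν - θ) P χ x with hM
  have iM := gigG_int (ν - θ) P χ hP hχ hθ
  have i0 := gigG_int ν P χ hP hχ hν
  have hI0pos : 0 < I0 := by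
    rw [hI0, setIntegral_pos_iff_support_of_nonneg_ae]
    · have : Function.support (gigG ν P χ) ∩ Ioi 0 = Ioi 0 := by
        apply inter_eq_right.2
        intro x hx
        exact (gigG_pos ν P χ x hx).ne'
      rw [this]; simp
    · filter_upwards [ae_restrict_mem measurableSet_Ioi] with x hx
      exact gigG_nonneg _ _ _ _ hx
    · exact i0
  have hM0 : 0 ≤ M := setIntegral_nonneg measurableSet_Ioi (fun x hx => gigG_nonneg _ _ _ _ hx)
  have key : ∀ ε : ℝ, 0 < ε → (1 + ε * B) * (I0 - (ε^2 * B / 2) ^ θ * M) ≤ I0 := by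
    intro ε hε
    have hq : 0 < χ + ε ^ 2 * B := by positivity
    have i1 := gigG_int ν P (χ + ε ^ 2 * B) hP hq.le (Or.inl hq)
    have h1 := H ε hε
    rw [gigH_eq ν P _ hP hq.le (Or.inl hq), gigH_eq ν P χ hP hχ hν,
      ← ENNReal.ofReal_mul (Real.exp_pos _).le, ENNReal.ofReal_le_ofReal_iff hI0pos.le] at h1
    have h2 : I0 - (ε^2 * B / 2) ^ θ * M ≤ ∫ x in Ioi (0:ℝ), gigG ν P (χ + ε ^ 2 * B) x := by
      rw [hI0, hM, ← integral_const_mul, ← integral_sub i0 (iM.const_mul _)]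
      refine setIntegral_mono_on (i0.sub (iM.const_mul _)) i1 measurableSet_Ioi ?_
      intro x hx
      have hx : 0 < x := hx
      have h3 := one_sub_exp_le (ε^2 * B / 2 / x) θ (by positivity) (by linarith) hθ1
      rw [Real.div_rpow (by positivity) hx.le] at h3
      have h4 : gigG (ν - θ) P χ x = gigG ν P χ x / x ^ θ := by
        unfold gigG
        rw [show ν - θ - 1 = ν - 1 - θ by ring, Real.rpow_sub hx]
        ring
      have h5 : gigG ν P (χ + ε ^ 2 * B) x = gigG ν P χ x * Real.exp (-(ε^2 * B / 2 / x)) := by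
        unfold gigG
        rw [mul_assoc, ← Real.exp_add]
        congr 2
        field_simp
        ring
      show gigG ν P χ x - (ε^2 * B / 2) ^ θ * gigG (ν - θ) P χ x ≤ _
      rw [h4, h5]
      have := mul_le_mul_of_nonneg_left h3 (gigG_nonneg ν P χ x hx)
      have e : gigG ν P χ x * ((ε^2 * B / 2) ^ θ / x ^ θ) =
        (ε^2 * B / 2) ^ θ * (gigG ν P χ x / x ^ θ) := by ring
      rw [e] at this
      linarith
    have h6 : 0 ≤ ∫ x in Ioi (0:ℝ), gigG ν P (χ + ε ^ 2 * B) x :=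
      setIntegral_nonneg measurableSet_Ioi (fun x hx => gigG_nonneg _ _ _ _ hx)
    have h7 := Real.add_one_le_exp (ε * B)
    calc _ ≤ (1 + ε * B) * ∫ x in Ioi (0:ℝ), gigG ν P (χ + ε ^ 2 * B) x := by gcongr
      _ ≤ Real.exp (ε * B) * ∫ x in Ioi (0:ℝ), gigG ν P (χ + ε ^ 2 * B) x := by
        gcongr; linarith
      _ ≤ _ := h1
  have key2 : ∀ ε : ℝ, 0 < ε → B * I0 ≤ (1 + ε * B) * ((B / 2) ^ θ * M) * ε ^ (2 * θ - 1) := by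
    intro ε hε
    have h1 := key ε hε
    have h2 : (ε^2 * B / 2) ^ θ = ε * ε ^ (2 * θ - 1) * (B / 2) ^ θ := by
      rw [show ε^2 * B / 2 = ε^2 * (B/2) by ring, Real.mul_rpow (by positivity) (by positivity),
        ← Real.rpow_natCast, ← Real.rpow_mul hε.le, Real.rpow_sub hε, Real.rpow_one]
      push_cast
      field_simp
    rw [h2] at h1
    refine le_of_mul_le_mul_left ?_ hε
    nlinarith
  have ht : Filter.Tendsto (fun ε : ℝ => (1 + ε * B) * ((B / 2) ^ θ * M) * ε ^ (2 * θ - 1))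
      (nhdsWithin 0 (Ioi 0)) (nhds ((1 + 0 * B) * ((B / 2) ^ θ * M) * 0 ^ (2 * θ - 1))) := by
    have : ContinuousAt (fun ε : ℝ => (1 + ε * B) * ((B / 2) ^ θ * M) * ε ^ (2 * θ - 1)) 0 := by
      refine ContinuousAt.mul (by fun_prop) ?_
      exact Real.continuousAt_rpow_const _ _ (Or.inr (by linarith))
    exact this.tendsto.mono_left nhdsWithin_le_nhds
  rw [Real.zero_rpow (by linarith), mul_zero] at ht
  have := ge_of_tendsto ht (b := B * I0) (by
    filter_upwards [self_mem_nhdsWithin] with ε hε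
    exact key2 ε hε)
  have := mul_pos hB hI0pos
  linarith

lemma gigH_top (ν P : ℝ) (hP : 0 < P) (hν : ν ≤ 0) : gigH ν P 0 = ∞ := by
  by_contra hne
  have h1 : IntegrableOn (gigG ν P 0) (Ioi 0) := by
    refine ⟨(gigG_meas _ _ _).aestronglyMeasurable, ?_⟩
    rw [hasFiniteIntegral_iff_ofReal]
    · exact lt_top_iff_ne_top.2 hne
    · filter_upwards [ae_restrict_mem measurableSet_Ioi] with x hx
      exact gigG_nonneg _ _ _ _ hx
  have h2 : IntegrableOn (fun x : ℝ => x ^ (ν - 1)) (Ioo 0 1) := by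
    refine Integrable.mono' ((h1.mono_set Ioo_subset_Ioi_self).const_mul (Real.exp (P / 2)))
      (by fun_prop) ?_
    filter_upwards [ae_restrict_mem measurableSet_Ioo] with x hx
    have hx0 : 0 < x := hx.1
    rw [Real.norm_of_nonneg (by positivity)]
    unfold gigG
    rw [mul_left_comm, ← Real.exp_add]
    apply le_mul_of_one_le_right (by positivity)
    apply Real.one_le_exp
    have := hx.2
    simp only [neg_zero, zero_div]
    nlinarith
  rw [intervalIntegral.integrableOn_Ioo_rpow_iff one_pos] at h2
  linarith

lemma lint_rpow (ν a b : ℝ) (hν : 0 < ν) (hab : a ≤ b) (ha : 0 ≤ a) :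
    ∫⁻ x in Ioc a b, ENNReal.ofReal (x ^ (ν - 1)) = ENNReal.ofReal ((b ^ ν - a ^ ν) / ν) := by
  have h := intervalIntegral.intervalIntegrable_rpow' (a := a) (b := b) (r := ν - 1) (by linarith)
  rw [intervalIntegrable_iff_integrableOn_Ioc_of_le hab] at h
  rw [← ofReal_integral_eq_lintegral_ofReal h, ← intervalIntegral.integral_of_le hab,
    integral_rpow (Or.inl (by linarith)), sub_add_cancel]
  filter_upwards [ae_restrict_mem measurableSet_Ioc] with x hx
  have : 0 < x := ha.trans_lt hx.1
  show 0 ≤ x ^ (ν - 1)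
  positivity

lemma level_bound (ν s r h : ℝ) (hν : 0 < ν) (hν2 : ν ≤ 1/2) (hs : 0 < s) (hr : 0 ≤ r)
    (hh : 0 ≤ h) (E E0 : Set ℝ)
    (hE : ∀ x ∈ E, 0 < x ∧ (r - s * x) ^ 2 ≤ h ^ 2 * x)
    (hE0 : ∀ x, 0 < x → (s * x) ^ 2 ≤ h ^ 2 * x → x ∈ E0) :
    ∫⁻ x in E, ENNReal.ofReal (x ^ (ν - 1)) ≤ ∫⁻ x in E0, ENNReal.ofReal (x ^ (ν - 1)) := by
  set d := √(h ^ 2 + 4 * r * s) with hd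
  have hd2 : d ^ 2 = h ^ 2 + 4 * r * s := Real.sq_sqrt (by positivity)
  have hd0 : 0 ≤ d := Real.sqrt_nonneg _
  have hdh : h ≤ d := by
    apply Real.le_sqrt_of_sq_le
    nlinarith [mul_nonneg hr hs.le]
  set tp := (d + h) / (2 * s) with htp
  set tm := (d - h) / (2 * s) with htm
  have etp : 2 * s * tp = d + h := by rw [htp]; field_simp
  have etm : 2 * s * tm = d - h := by rw [htm]; field_simp
  have htm0 : 0 ≤ tm := div_nonneg (by linarith) (by positivity)
  have hdiff : tp = tm + h / s := by rw [htp, htm]; field_simp; ring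
  have hhs : 0 ≤ h / s := by positivity
  have hle : tm ≤ tp := by linarith
  have htp0 : 0 ≤ tp := by linarith
  have sub1 : E ⊆ Icc (tm ^ 2) (tp ^ 2) := by
    intro x hx
    obtain ⟨hx0, hx1⟩ := hE x hx
    set u := √x with hu
    have hu0 : 0 < u := Real.sqrt_pos.2 hx0
    have hux : x = u ^ 2 := (Real.sq_sqrt hx0.le).symm
    have hab : |r - s * x| ≤ h * u := by
      apply abs_le_of_sq_le_sq _ (by positivity)
      rw [mul_pow, ← hux]; exact hx1
    rw [abs_le, hux] at hab
    obtain ⟨ha, hb⟩ := hab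
    have h1 : u ≤ tp := by
      have : 2 * s * u - h ≤ d := by
        apply abs_le_of_sq_le_sq' _ hd0 |>.2
        rw [hd2]; nlinarith
      have : 2 * s * u ≤ 2 * s * tp := by linarith
      exact le_of_mul_le_mul_left this (by positivity)
    have h2 : tm ≤ u := by
      have : d ≤ 2 * s * u + h := by
        apply abs_le_of_sq_le_sq' _ (by positivity) |>.2
        rw [hd2]; nlinarith
      have : 2 * s * tm ≤ 2 * s * u := by linarith
      exact le_of_mul_le_mul_left this (by positivity)
    rw [hux]
    constructor <;> gcongr
  have sub0 : Ioc 0 ((h / s) ^ 2) ⊆ E0 := by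
    intro x hx
    apply hE0 x hx.1
    have h1 := hx.2
    have h0 := hx.1
    rw [div_pow, le_div_iff₀ (by positivity)] at h1
    nlinarith
  calc _ ≤ ∫⁻ x in Icc (tm ^ 2) (tp ^ 2), ENNReal.ofReal (x ^ (ν - 1)) := lintegral_mono_set sub1
    _ = ∫⁻ x in Ioc (tm ^ 2) (tp ^ 2), ENNReal.ofReal (x ^ (ν - 1)) := by
      rw [restrict_Ioc_eq_restrict_Icc]
    _ ≤ ∫⁻ x in Ioc 0 ((h / s) ^ 2), ENNReal.ofReal (x ^ (ν - 1)) := by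
      rw [lint_rpow ν _ _ hν (by gcongr) (by positivity),
        lint_rpow ν _ _ hν (by positivity) le_rfl]
      apply ENNReal.ofReal_le_ofReal
      gcongr ?_ / _
      rw [Real.zero_rpow hν.ne', sub_zero, ← Real.rpow_natCast, ← Real.rpow_natCast,
        ← Real.rpow_natCast, ← Real.rpow_mul htp0, ← Real.rpow_mul htm0, ← Real.rpow_mul hhs, hdiff]
      have := Real.rpow_add_le_add_rpow (p := (2:ℕ) * ν) htm0 hhs (by positivity)
        (by push_cast; linarith)
      linarith
    _ ≤ _ := lintegral_mono_set sub0

lemma gig_mono (ν s r : ℝ) (hν : 0 < ν) (hν2 : ν ≤ 1/2) (hs : 0 < s) (hr : 0 ≤ r) :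
    ENNReal.ofReal (Real.exp (r * s)) * gigH ν (s ^ 2) (r ^ 2) ≤ gigH ν (s ^ 2) 0 := by
  have hw : Measurable (fun x : ℝ => ENNReal.ofReal (x ^ (ν - 1))) := by fun_prop
  set m := (volume.restrict (Ioi (0:ℝ))).withDensity (fun x : ℝ => ENNReal.ofReal (x ^ (ν - 1)))
    with hm
  have hF : ∀ r : ℝ, Measurable (fun x : ℝ => Real.exp (-(r - s * x) ^ 2 / (2 * x))) := by
    intro r; fun_prop
  have rep : ∀ r : ℝ, ENNReal.ofReal (Real.exp (r * s)) * gigH ν (s ^ 2) (r ^ 2) =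
      ∫⁻ t in Ioi (0:ℝ), m {x | t ≤ Real.exp (-(r - s * x) ^ 2 / (2 * x))} := by
    intro r
    rw [← lintegral_eq_lintegral_meas_le m (Filter.Eventually.of_forall fun x => (Real.exp_pos _).le)
      (hF r).aemeasurable, hm, lintegral_withDensity_eq_lintegral_mul _ hw (hF r).ennreal_ofReal,
      gigH, ← lintegral_const_mul _ (gigG_meas _ _ _).ennreal_ofReal]
    refine setLIntegral_congr_fun measurableSet_Ioi ?_
    intro x hx
    have hx : 0 < x := hx
    simp only [Pi.mul_apply]
    rw [← ENNReal.ofReal_mul (Real.exp_pos _).le, ← ENNReal.ofReal_mul (by positivity)]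
    congr 1
    unfold gigG
    rw [mul_left_comm, ← Real.exp_add]
    congr 2
    field_simp
    ring
  have r0 := rep 0
  rw [zero_mul, Real.exp_zero, ENNReal.ofReal_one, one_mul, zero_pow two_ne_zero] at r0
  rw [r0, rep r]
  refine setLIntegral_mono' measurableSet_Ioi ?_
  intro t ht
  have ht : 0 < t := ht
  have mS : ∀ r : ℝ, MeasurableSet {x | t ≤ Real.exp (-(r - s * x) ^ 2 / (2 * x))} :=
    fun r => measurableSet_le measurable_const (hF r)
  rw [hm, withDensity_apply _ (mS r), withDensity_apply _ (mS 0), Measure.restrict_restrict (mS r),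
    Measure.restrict_restrict (mS 0)]
  rcases le_or_gt t 1 with h1 | h1
  · have hl : 0 ≤ -2 * Real.log t := by nlinarith [Real.log_nonpos ht.le h1]
    have hiff : ∀ r x : ℝ, 0 < x → (t ≤ Real.exp (-(r - s * x) ^ 2 / (2 * x)) ↔
        (r - s * x) ^ 2 ≤ (√(-2 * Real.log t)) ^ 2 * x) := by
      intro r x hx
      rw [Real.sq_sqrt hl, ← Real.log_le_iff_le_exp ht, le_div_iff₀ (by positivity)]
      constructor <;> intro h <;> linarith
    refine level_bound ν s r (√(-2 * Real.log t)) hν hν2 hs hr (Real.sqrt_nonneg _) _ _ ?_ ?_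
    · rintro x ⟨hx, hx0⟩
      exact ⟨hx0, (hiff r x hx0).1 hx⟩
    · intro x hx0 hx
      refine ⟨(hiff 0 x hx0).2 ?_, hx0⟩
      rw [zero_sub, neg_sq]; exact hx
  · have : {x | t ≤ Real.exp (-(r - s * x) ^ 2 / (2 * x))} ∩ Ioi 0 = ∅ := by
      ext x
      simp only [mem_inter_iff, mem_ofPred_eq, mem_Ioi, mem_empty_iff_false, iff_false, not_and]
      intro hx hx0
      have : Real.exp (-(r - s * x) ^ 2 / (2 * x)) ≤ 1 := by
        rw [Real.exp_le_one_iff]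
        apply div_nonpos_of_nonpos_of_nonneg _ (by positivity)
        nlinarith [sq_nonneg (r - s * x)]
      linarith
    rw [this]
    simp

/-- Corollary 2(ii): the mode of the multivariate generalized hyperbolic density is at
`μ` iff `β = 0`, or `χ = 0` and `0 < λ ≤ (p+1)/2`. -/
theorem multivariate_generalized_hyperbolic_mode_at_mu_iff
    (p : ℕ) (hp : 1 ≤ p)
    (μ β : Fin p → ℝ)
    (A : Matrix (Fin p) (Fin p) ℝ) (hA : IsUnit A.det)
    (lam χ ψ : ℝ)
    (hlam_pos : 0 < lam → 0 ≤ χ ∧ 0 < ψ)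
    (hlam_zero : lam = 0 → 0 < χ ∧ 0 < ψ)
    (hlam_neg : lam < 0 → 0 < χ ∧ 0 ≤ ψ)
    (f : (Fin p → ℝ) → ℝ≥0∞)
    (hf : ∀ y, f y = ENNReal.ofReal |A.det|⁻¹ * ∫⁻ x in Ioi (0:ℝ), ENNReal.ofReal
      ((2 * π * x) ^ (-(p:ℝ)/2) *
        Real.exp (-(∑ i, (A⁻¹.mulVec (y - μ - x • β) i) ^ 2) / (2 * x)) *
        (x ^ (lam - 1) * Real.exp (-(χ / x + ψ * x) / 2)))) :
    (∀ y, f y ≤ f μ) ↔ (β = 0 ∨ (χ = 0 ∧ 0 < lam ∧ lam ≤ ((p:ℝ) + 1)/2)) := by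
  set b := A⁻¹.mulVec β with hb
  set B := ∑ i, b i ^ 2 with hB
  have hB0 : 0 ≤ B := Finset.sum_nonneg fun i _ => sq_nonneg _
  set C := ENNReal.ofReal |A.det|⁻¹ * ENNReal.ofReal ((2 * π) ^ (-(p:ℝ)/2)) with hC
  have hdet : A.det ≠ 0 := hA.ne_zero
  have hC0 : C ≠ 0 := by
    apply mul_ne_zero
    · exact (ENNReal.ofReal_pos.2 (by positivity)).ne'
    · exact (ENNReal.ofReal_pos.2 (by positivity)).ne'
  have hCt : C ≠ ∞ := ENNReal.mul_ne_top ENNReal.ofReal_ne_top ENNReal.ofReal_ne_top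
  have rep : ∀ y, f y = C * (ENNReal.ofReal (Real.exp (∑ i, A⁻¹.mulVec (y - μ) i * b i)) *
      gigH (lam - p / 2) (ψ + B) (χ + ∑ i, A⁻¹.mulVec (y - μ) i ^ 2)) := by
    intro y
    rw [hf y, hC, mul_assoc]
    congr 1
    rw [← mul_assoc, gigH, ← ENNReal.ofReal_mul (by positivity),
      ← lintegral_const_mul _ (gigG_meas _ _ _).ennreal_ofReal]
    refine setLIntegral_congr_fun measurableSet_Ioi ?_
    intro x hx
    have hx : 0 < x := hx
    simp only
    rw [← ENNReal.ofReal_mul (by positivity)]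
    congr 1
    set v := A⁻¹.mulVec (y - μ) with hv
    have e1 : ∑ i, (A⁻¹.mulVec (y - μ - x • β) i) ^ 2 =
        ∑ i, v i ^ 2 - 2 * x * ∑ i, v i * b i + x ^ 2 * B := by
      rw [hB, Finset.mul_sum, Finset.mul_sum, ← Finset.sum_sub_distrib, ← Finset.sum_add_distrib]
      refine Finset.sum_congr rfl fun i _ => ?_
      rw [Matrix.mulVec_sub, Matrix.mulVec_smul]
      simp only [Pi.sub_apply, Pi.smul_apply, smul_eq_mul]
      ring
    rw [e1]
    unfold gigG
    rw [Real.mul_rpow (by positivity) hx.le,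
      show lam - (p:ℝ) / 2 - 1 = -(p:ℝ)/2 + (lam - 1) by ring, Real.rpow_add hx]
    have e2 : Real.exp (-(∑ i, v i ^ 2 - 2 * x * ∑ i, v i * b i + x ^ 2 * B) / (2 * x)) *
        Real.exp (-(χ / x + ψ * x) / 2) = Real.exp (∑ i, v i * b i) *
        Real.exp (-(χ + ∑ i, v i ^ 2) / (2 * x) - (ψ + B) * x / 2) := by
      rw [← Real.exp_add, ← Real.exp_add]
      congr 1
      field_simp
      ring
    linear_combination ((2 * π) ^ (-(p:ℝ)/2) * x ^ (-(p:ℝ)/2) * x ^ (lam - 1)) * e2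
  have repμ : f μ = C * gigH (lam - p / 2) (ψ + B) χ := by
    rw [rep μ]; simp
  have hχ0 : 0 ≤ χ := by
    rcases lt_trichotomy lam 0 with h | h | h
    · exact (hlam_neg h).1.le
    · exact (hlam_zero h).1.le
    · exact (hlam_pos h).1
  have hψ0 : 0 ≤ ψ := by
    rcases lt_trichotomy lam 0 with h | h | h
    · exact (hlam_neg h).2
    · exact (hlam_zero h).2.le
    · exact (hlam_pos h).2.le
  have hle : ∀ y, f y ≤ f μ ↔ ENNReal.ofReal (Real.exp (∑ i, A⁻¹.mulVec (y - μ) i * b i)) *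
      gigH (lam - p / 2) (ψ + B) (χ + ∑ i, A⁻¹.mulVec (y - μ) i ^ 2) ≤
      gigH (lam - p / 2) (ψ + B) χ := by
    intro y
    rw [rep y, repμ, ENNReal.mul_le_mul_iff_right hC0 hCt]
  constructor
  · intro H
    by_contra hcon
    push Not at hcon
    obtain ⟨hβ, hcon⟩ := hcon
    have hb0 : b ≠ 0 := by
      intro h0
      apply hβ
      have : A.mulVec b = β := by
        rw [hb, Matrix.mulVec_mulVec, Matrix.mul_nonsing_inv _ hA, Matrix.one_mulVec]
      rw [← this, h0, Matrix.mulVec_zero]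
    have hBpos : 0 < B := by
      refine lt_of_le_of_ne hB0 fun h => hb0 ?_
      have := (Finset.sum_eq_zero_iff_of_nonneg (fun i _ => sq_nonneg (b i))).1 h.symm
      ext i
      simpa using this i (Finset.mem_univ i)
    refine gig_fwd (lam - p / 2) (ψ + B) χ B (by linarith) hχ0 hBpos ?_ ?_
    · rcases hχ0.eq_or_lt with h | h
      · right
        have hl : 0 < lam := by
          rcases lt_trichotomy lam 0 with h' | h' | h'
          · linarith [(hlam_neg h').1]
          · linarith [(hlam_zero h').1]
          · exact h'
        have := hcon h.symm hl
        linarith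
      · exact Or.inl h
    · intro ε hε
      have h := (hle (μ + A.mulVec (ε • b))).1 (H _)
      have e : A⁻¹.mulVec (μ + A.mulVec (ε • b) - μ) = ε • b := by
        rw [add_sub_cancel_left, Matrix.mulVec_mulVec, Matrix.nonsing_inv_mul _ hA,
          Matrix.one_mulVec]
      have e1 : ∑ i, (ε • b) i * b i = ε * B := by
        rw [hB, Finset.mul_sum]
        refine Finset.sum_congr rfl fun i _ => ?_
        simp only [Pi.smul_apply, smul_eq_mul]; ring
      have e2 : ∑ i, (ε • b) i ^ 2 = ε ^ 2 * B := by
        rw [hB, Finset.mul_sum]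
        refine Finset.sum_congr rfl fun i _ => ?_
        simp only [Pi.smul_apply, smul_eq_mul]; ring
      rwa [e, e1, e2] at h
  · intro H y
    rw [hle y]
    set v := A⁻¹.mulVec (y - μ) with hv
    have hv0 : 0 ≤ ∑ i, v i ^ 2 := Finset.sum_nonneg fun i _ => sq_nonneg _
    rcases H with H | ⟨h1, h2, h3⟩
    · have : b = 0 := by rw [hb, H, Matrix.mulVec_zero]
      have e : ∑ i, v i * b i = 0 := by simp [this]
      rw [e, Real.exp_zero, ENNReal.ofReal_one, one_mul]
      exact gigH_anti _ _ _ _ (by linarith)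
    · have hψ := (hlam_pos h2).2
      have hP : 0 < ψ + B := by linarith
      rw [h1]
      rcases le_or_gt (lam - p / 2) 0 with h | h
      · rw [gigH_top _ _ hP h]; exact le_top
      · have key := gig_mono (lam - p / 2) (√(ψ + B)) (√(∑ i, v i ^ 2)) h (by linarith)
          (Real.sqrt_pos.2 hP) (Real.sqrt_nonneg _)
        rw [Real.sq_sqrt hP.le, Real.sq_sqrt hv0] at key
        rw [zero_add]
        refine le_trans ?_ key
        gcongr
        refine (Real.sum_mul_le_sqrt_mul_sqrt Finset.univ v b).trans ?_
        gcongr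
        linarith
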